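/- arXiv:2403.14604 — 3 statements merged into one kernel-verified Lean document; each statement's English description precedes it below -/
import Mathlib

section
/- For positive integers k₁, k₂ with k₂ ≥ 2 and k₁ + k₂ odd, the double zeta value ζ(k₁,k₂) is a ℚ[π²]-linear combination of single zeta values; explicitly, ζ(k₁,k₂) lies in the ℚ-span of {π^{2a}·ζ(b) : 2a + b = k₁ + k₂, b ≥ 3 odd} together with {π^{k₁+k₂-? } }, i.e., of products of π² powers and depth-one zeta values of total weight k₁+k₂. -/
open scoped BigOperators
open Real

/-- The multiple zeta value `ζ(k₁,…,k_d) = ∑_{0<m₁<⋯<m_d} ∏ 1/m_i^{k_i}`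
(as a `tsum` over strictly increasing tuples of positive integers). -/
noncomputable def MZV (k : List ℕ) : ℝ :=
  ∑' m : {f : Fin k.length → ℕ+ // StrictMono f}, ∏ i, 1 / ((m.1 i : ℕ) : ℝ) ^ k.get i

/-- `n ↦ n⁻ᵖ` on the integers, set to `0` at `n = 0` for every exponent, including `p = 0`. -/
noncomputable def invPow (p : ℕ) (n : ℤ) : ℝ := if n = 0 then 0 else ((n : ℝ) ^ p)⁻¹

/-- The general term `x⁻ᵃ y⁻ᵇ (x + y)⁻ᶜ` of the Tornheim series. -/
noncomputable def tornheimTerm (a b c : ℕ) (x : ℕ+ × ℕ+) : ℝ :=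
  ((x.1 : ℝ) ^ a * (x.2 : ℝ) ^ b * ((x.1 : ℝ) + x.2) ^ c)⁻¹

/-- The Tornheim series `∑ x⁻ᵃ y⁻ᵇ (x + y)⁻ᶜ` over pairs of positive integers. -/
noncomputable def tornheim (a b c : ℕ) : ℝ := ∑' x, tornheimTerm a b c x

/-- The zeta value `ζ(b)` as a sum over positive integers. -/
noncomputable def zetaVal (b : ℕ) : ℝ := ∑' n : ℕ+, 1 / ((n : ℕ) : ℝ) ^ b

/-- The rational span of the products `π^{2a} ζ(b)` with `b ≥ 3` odd and `2a + b = N`. -/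
noncomputable def paritySpan (N : ℕ) : Submodule ℚ ℝ :=
  Submodule.span ℚ {x : ℝ | ∃ a b : ℕ,
    2 * a + b = N ∧ 3 ≤ b ∧ Odd b ∧ x = π ^ (2 * a) * ∑' n : ℕ+, 1 / ((n : ℕ) : ℝ) ^ b}

theorem HasSum.of_injective_pair {α β γ : Type*} {f : α → ℝ} {i : β → α} {j : γ → α} {s t : ℝ}
    (hi : Function.Injective i) (hj : Function.Injective j) (hij : ∀ x y, i x ≠ j y)
    (h0 : ∀ a, a ∉ Set.range i → a ∉ Set.range j → f a = 0)
    (hs : HasSum (fun x => f (i x)) s) (ht : HasSum (fun x => f (j x)) t) :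
    HasSum f (s + t) := by
  have hinj : Function.Injective (Sum.elim i j) := hi.sumElim hj hij
  rw [← hinj.hasSum_iff]
  · exact HasSum.sum hs ht
  · intro a ha
    rw [Set.Sum.elim_range] at ha
    exact h0 a (fun h => ha (Or.inl h)) (fun h => ha (Or.inr h))

theorem hasSum_pnat_prod_of_trichotomy {f : ℕ+ × ℕ+ → ℝ} {s t u : ℝ}
    (hs : HasSum (fun x : ℕ+ × ℕ+ => f (x.1 + x.2, x.2)) s)
    (ht : HasSum (fun x : ℕ+ × ℕ+ => f (x.1, x.1 + x.2)) t)
    (hu : HasSum (fun n : ℕ+ => f (n, n)) u) : HasSum f (s + (t + u)) := by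
  have key : ∀ a b : ℕ+, a < b → ∃ c, a + c = b := fun a b h => ⟨b - a, PNat.add_sub_of_lt h⟩
  refine HasSum.of_injective_pair (i := fun x : ℕ+ × ℕ+ => (x.1 + x.2, x.2))
    (j := Sum.elim (fun x : ℕ+ × ℕ+ => (x.1, x.1 + x.2)) (fun n : ℕ+ => (n, n)))
    ?_ ?_ ?_ ?_ hs (HasSum.sum ht hu)
  · rintro ⟨a, b⟩ ⟨c, d⟩ h
    simp only [Prod.mk.injEq] at h
    obtain ⟨h1, rfl⟩ := h
    simpa using h1
  · refine Function.Injective.sumElim ?_ ?_ ?_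
    · rintro ⟨a, b⟩ ⟨c, d⟩ h
      simp only [Prod.mk.injEq] at h
      obtain ⟨rfl, h1⟩ := h
      simpa using h1
    · intro a b h
      exact (Prod.mk.inj h).1
    · rintro ⟨a, b⟩ c h
      simp only [Prod.mk.injEq] at h
      have := b.pos
      simp only [← PNat.coe_inj, PNat.add_coe] at h
      omega
  · rintro ⟨a, b⟩ (⟨c, d⟩ | c) h
    · simp only [Sum.elim_inl, Prod.mk.injEq, ← PNat.coe_inj, PNat.add_coe] at h
      have := a.pos
      have := d.pos
      omega
    · simp only [Sum.elim_inr, Prod.mk.injEq, ← PNat.coe_inj, PNat.add_coe] at h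
      have := a.pos
      omega
  · rintro ⟨a, b⟩ h1 h2
    exfalso
    rcases lt_trichotomy a b with h | rfl | h
    · obtain ⟨c, rfl⟩ := key a b h
      exact h2 ⟨Sum.inl (a, c), rfl⟩
    · exact h2 ⟨Sum.inr a, rfl⟩
    · obtain ⟨c, rfl⟩ := key b a h
      exact h1 ⟨(c, b), by simp [add_comm]⟩

theorem hasSum_prod_int_of_pos_neg {f : ℕ+ × ℤ → ℝ} {s t : ℝ}
    (hs : HasSum (fun x : ℕ+ × ℕ+ => f (x.1, (x.2 : ℤ))) s)
    (ht : HasSum (fun x : ℕ+ × ℕ+ => f (x.1, -(x.2 : ℤ))) t)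
    (h0 : ∀ d, f (d, 0) = 0) : HasSum f (s + t) := by
  refine HasSum.of_injective_pair (i := fun x : ℕ+ × ℕ+ => (x.1, ((x.2 : ℕ) : ℤ)))
    (j := fun x : ℕ+ × ℕ+ => (x.1, -((x.2 : ℕ) : ℤ))) ?_ ?_ ?_ ?_ hs ht
  · rintro ⟨a, b⟩ ⟨c, d⟩ h
    simpa using h
  · rintro ⟨a, b⟩ ⟨c, d⟩ h
    simpa using h
  · rintro ⟨a, b⟩ ⟨c, d⟩ h
    simp only [Prod.mk.injEq] at h
    have := b.pos
    have := d.pos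
    omega
  · rintro ⟨a, n⟩ h1 h2
    rcases lt_trichotomy n 0 with h | rfl | h
    · refine absurd ⟨(a, ⟨n.natAbs, by omega⟩), ?_⟩ h2
      simp only [PNat.mk_coe, Prod.mk.injEq, true_and]
      omega
    · exact h0 a
    · refine absurd ⟨(a, ⟨n.natAbs, by omega⟩), ?_⟩ h1
      simp only [PNat.mk_coe, Prod.mk.injEq, true_and]
      omega

theorem tornheimTerm_nonneg (a b c : ℕ) (x : ℕ+ × ℕ+) : 0 ≤ tornheimTerm a b c x := by
  unfold tornheimTerm
  positivity

theorem one_le_pnat_cast (n : ℕ+) : (1 : ℝ) ≤ n := by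
  exact_mod_cast n.pos

theorem summable_pnat_rpow_inv {p : ℝ} (hp : 1 < p) :
    Summable fun n : ℕ+ => ((n : ℝ) ^ p)⁻¹ :=
  (Real.summable_nat_rpow_inv.2 hp).comp_injective PNat.coe_injective

theorem summable_pnat_pow_inv {p : ℕ} (hp : 2 ≤ p) :
    Summable fun n : ℕ+ => ((n : ℝ) ^ p)⁻¹ :=
  (Real.summable_nat_pow_inv.2 hp).comp_injective PNat.coe_injective

theorem summable_tornheimTerm_one : Summable (tornheimTerm 1 1 1) := by
  have h := summable_pnat_rpow_inv (p := 3 / 2) (by norm_num)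
  refine Summable.of_nonneg_of_le (tornheimTerm_nonneg 1 1 1) ?_
    (h.mul_of_nonneg h (fun n => by positivity) (fun n => by positivity))
  rintro ⟨x, y⟩
  have hx := one_le_pnat_cast x
  have hy := one_le_pnat_cast y
  have h32 : ∀ z : ℝ, 1 ≤ z → z ^ (3 / 2 : ℝ) = z * √z := fun z hz => by
    rw [show (3 / 2 : ℝ) = 1 + 1 / 2 by norm_num, Real.rpow_add (by linarith), Real.rpow_one,
      Real.sqrt_eq_rpow]
  simp only [tornheimTerm, pow_one]
  rw [h32 _ hx, h32 _ hy, ← mul_inv]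
  refine inv_anti₀ (by positivity) ?_
  have hs : √(x : ℝ) * √(y : ℝ) ≤ x + y := by
    nlinarith [Real.sq_sqrt (show (0 : ℝ) ≤ x by positivity),
      Real.sq_sqrt (show (0 : ℝ) ≤ y by positivity), sq_nonneg (√(x : ℝ) - √(y : ℝ)),
      Real.sqrt_nonneg (x : ℝ), Real.sqrt_nonneg (y : ℝ)]
  calc (x : ℝ) * √x * (y * √y) = x * y * (√x * √y) := by ring
    _ ≤ x * y * (x + y) := by gcongr

theorem summable_tornheimTerm_of_le {a b c a' b' c' : ℕ} (h : Summable (tornheimTerm a b c))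
    (ha : a ≤ a') (hb : b ≤ b') (hc : c ≤ c') : Summable (tornheimTerm a' b' c') := by
  refine Summable.of_nonneg_of_le (tornheimTerm_nonneg _ _ _) ?_ h
  rintro ⟨x, y⟩
  have hx := one_le_pnat_cast x
  have hy := one_le_pnat_cast y
  have hxy : (1 : ℝ) ≤ x + y := by linarith
  unfold tornheimTerm
  gcongr

theorem tornheimTerm_split (a b c : ℕ) (x : ℕ+ × ℕ+) :
    tornheimTerm (a + 1) (b + 1) c x =
      tornheimTerm a (b + 1) (c + 1) x + tornheimTerm (a + 1) b (c + 1) x := by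
  have hx := one_le_pnat_cast x.1
  have hy := one_le_pnat_cast x.2
  have : (x.1 : ℝ) + x.2 ≠ 0 := by linarith
  unfold tornheimTerm
  field_simp
  ring

theorem summable_tornheimTerm_double_left : Summable (tornheimTerm 1 0 2) :=
  Summable.of_nonneg_of_le (tornheimTerm_nonneg _ _ _) (fun x => by
    rw [tornheimTerm_split 0 0 1]
    linarith [tornheimTerm_nonneg 0 1 2 x]) summable_tornheimTerm_one

theorem summable_tornheimTerm_double_right : Summable (tornheimTerm 0 1 2) :=
  Summable.of_nonneg_of_le (tornheimTerm_nonneg _ _ _) (fun x => by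
    rw [tornheimTerm_split 0 0 1]
    linarith [tornheimTerm_nonneg 1 0 2 x]) summable_tornheimTerm_one

theorem summable_tornheimTerm_prod : Summable (tornheimTerm 2 2 0) := by
  have h := summable_pnat_pow_inv (p := 2) le_rfl
  refine (h.mul_of_nonneg h (fun n => by positivity) (fun n => by positivity)).congr fun x => ?_
  simp [tornheimTerm, mul_comm]

theorem summable_tornheimTerm {a b c : ℕ} (hab : 1 ≤ a + b) (hac : 2 ≤ a + c) (hbc : 2 ≤ b + c) :
    Summable (tornheimTerm a b c) := by
  rcases Nat.lt_or_ge c 2 with hc | hc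
  · rcases Nat.eq_zero_or_pos c with h | h
    · exact summable_tornheimTerm_of_le summable_tornheimTerm_prod (by omega) (by omega) (by omega)
    · exact summable_tornheimTerm_of_le summable_tornheimTerm_one (by omega) (by omega) (by omega)
  · rcases Nat.eq_zero_or_pos a with h | h
    · exact summable_tornheimTerm_of_le summable_tornheimTerm_double_right
        (by omega) (by omega) (by omega)
    · exact summable_tornheimTerm_of_le summable_tornheimTerm_double_left
        (by omega) (by omega) (by omega)

theorem tornheim_split {a b c : ℕ} (hac : 1 ≤ a + c) (hbc : 1 ≤ b + c) :
    tornheim (a + 1) (b + 1) c = tornheim a (b + 1) (c + 1) + tornheim (a + 1) b (c + 1) := by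
  unfold tornheim
  rw [← Summable.tsum_add]
  · exact tsum_congr (tornheimTerm_split a b c)
  · exact summable_tornheimTerm (by omega) (by omega) (by omega)
  · exact summable_tornheimTerm (by omega) (by omega) (by omega)

theorem tornheim_comm (a b c : ℕ) : tornheim a b c = tornheim b a c := by
  unfold tornheim
  rw [← (Equiv.prodComm ℕ+ ℕ+).tsum_eq]
  refine tsum_congr fun x => ?_
  simp only [tornheimTerm, Equiv.prodComm_apply, Prod.fst_swap, Prod.snd_swap]
  rw [mul_comm ((x.2 : ℝ) ^ a), add_comm (x.2 : ℝ)]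

theorem invPow_zero_right (p : ℕ) : invPow p 0 = 0 := by simp [invPow]

theorem invPow_of_ne_zero (p : ℕ) {n : ℤ} (hn : n ≠ 0) : invPow p n = ((n : ℝ) ^ p)⁻¹ := by
  simp [invPow, hn]

theorem invPow_pnat (p : ℕ) (n : ℕ+) : invPow p (n : ℤ) = ((n : ℝ) ^ p)⁻¹ := by
  rw [invPow_of_ne_zero p (by have := n.pos; omega)]
  simp

theorem invPow_neg (p : ℕ) (n : ℤ) : invPow p (-n) = (-1) ^ p * invPow p n := by
  rcases eq_or_ne n 0 with rfl | hn
  · simp [invPow]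
  · rw [invPow_of_ne_zero p hn, invPow_of_ne_zero p (neg_ne_zero.2 hn)]
    push_cast
    rw [neg_pow, mul_inv, ← inv_pow, inv_neg_one]

theorem zetaVal_eq (b : ℕ) : zetaVal b = ∑' n : ℕ+, ((n : ℝ) ^ b)⁻¹ := by
  simp [zetaVal]

theorem hasSum_zetaVal {b : ℕ} (hb : 2 ≤ b) :
    HasSum (fun n : ℕ+ => ((n : ℝ) ^ b)⁻¹) (zetaVal b) := by
  rw [zetaVal_eq]
  exact (summable_pnat_pow_inv hb).hasSum

theorem hasSum_tornheim {a b c : ℕ} (hab : 1 ≤ a + b) (hac : 2 ≤ a + c) (hbc : 2 ≤ b + c) :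
    HasSum (tornheimTerm a b c) (tornheim a b c) :=
  (summable_tornheimTerm hab hac hbc).hasSum

theorem tornheim_prod {p q : ℕ} (hp : 2 ≤ p) (hq : 2 ≤ q) :
    tornheim p q 0 = zetaVal p * zetaVal q := by
  have hs : Summable fun x : ℕ+ × ℕ+ => ((x.1 : ℝ) ^ p)⁻¹ * ((x.2 : ℝ) ^ q)⁻¹ :=
    (summable_pnat_pow_inv hp).mul_of_nonneg (summable_pnat_pow_inv hq)
      (fun n => by positivity) (fun n => by positivity)
  rw [zetaVal_eq, zetaVal_eq,
    (summable_pnat_pow_inv hp).tsum_mul_tsum (summable_pnat_pow_inv hq) hs]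
  refine tsum_congr fun x => ?_
  simp [tornheimTerm, mul_comm]

theorem zetaVal_stuffle {p q : ℕ} (hp : 2 ≤ p) (hq : 2 ≤ q) :
    zetaVal p * zetaVal q = tornheim q 0 p + (tornheim p 0 q + zetaVal (p + q)) := by
  rw [← tornheim_prod hp hq, tornheim_comm q 0 p]
  refine HasSum.tsum_eq (hasSum_pnat_prod_of_trichotomy ?_ ?_ ?_)
  · refine (hasSum_tornheim (a := 0) (b := q) (c := p) (by omega) (by omega)
      (by omega)).congr_fun fun x => ?_
    simp [tornheimTerm, mul_comm]
  · refine (hasSum_tornheim (a := p) (b := 0) (c := q) (by omega) (by omega)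
      (by omega)).congr_fun fun x => ?_
    simp [tornheimTerm, mul_comm]
  · refine (hasSum_zetaVal (b := p + q) (by omega)).congr_fun fun x => ?_
    simp [tornheimTerm, pow_add, mul_comm]

theorem hasSum_pnat_int {p q r : ℕ} (hp : 1 ≤ p) (hq : 1 ≤ q) (hpr : 2 ≤ p + r)
    (hqr : 2 ≤ q + r) :
    HasSum (fun x : ℕ+ × ℤ => ((x.1 : ℝ) ^ r)⁻¹ * (invPow p (x.2 + x.1) * invPow q x.2))
      (tornheim r q p + (-1) ^ q * (tornheim p q r + (-1) ^ p * tornheim r p q)) := by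
  refine hasSum_prod_int_of_pos_neg ?_ ?_ fun d => by simp [invPow_zero_right]
  · refine (hasSum_tornheim (a := r) (b := q) (c := p) (by omega) (by omega)
      (by omega)).congr_fun fun x => ?_
    have : ((x.2 : ℕ) : ℤ) + (x.1 : ℕ) = ((x.1 + x.2 : ℕ+) : ℕ) := by push_cast; ring
    simp only
    rw [this, invPow_pnat, invPow_pnat, tornheimTerm, PNat.add_coe, mul_inv, mul_inv]
    push_cast
    ring
  · have h : HasSum (fun x : ℕ+ × ℕ+ => ((x.1 : ℝ) ^ r)⁻¹ *
        (invPow p ((x.1 : ℤ) - (x.2 : ℤ)) * ((x.2 : ℝ) ^ q)⁻¹))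
        (tornheim p q r + ((-1) ^ p * tornheim r p q + 0)) := by
      refine hasSum_pnat_prod_of_trichotomy ?_ ?_ ?_
      · refine (hasSum_tornheim (a := p) (b := q) (c := r) (by omega) (by omega)
          (by omega)).congr_fun fun x => ?_
        have : ((x.1 + x.2 : ℕ+) : ℤ) - (x.2 : ℤ) = (x.1 : ℤ) := by push_cast; ring
        simp only
        rw [this, invPow_pnat, tornheimTerm, PNat.add_coe, mul_inv, mul_inv]
        push_cast
        ring
      · refine ((hasSum_tornheim (a := r) (b := p) (c := q) (by omega) (by omega)
          (by omega)).mul_left ((-1) ^ p)).congr_fun fun x => ?_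
        have : (x.1 : ℤ) - ((x.1 + x.2 : ℕ+) : ℤ) = -(x.2 : ℤ) := by push_cast; ring
        simp only
        rw [this, invPow_neg, invPow_pnat, tornheimTerm, PNat.add_coe, mul_inv, mul_inv]
        push_cast
        ring
      · simp [invPow_zero_right, hasSum_zero]
    rw [add_zero] at h
    refine (h.mul_left ((-1) ^ q)).congr_fun fun x => ?_
    simp only
    rw [invPow_neg, invPow_pnat, neg_add_eq_sub]
    ring

/-- Rational combinations of the functions `d ↦ π^{2j} d⁻ᵉ` with `2j + e = N` and `e ≥ m`. -/
noncomputable def fiberSpan (N m : ℕ) : Submodule ℚ (ℕ+ → ℝ) :=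
  Submodule.span ℚ {g : ℕ+ → ℝ | ∃ j e : ℕ,
    2 * j + e = N ∧ m ≤ e ∧ g = fun d : ℕ+ => π ^ (2 * j) * ((d : ℝ) ^ e)⁻¹}

theorem fiberSpan_mul_inv {N m : ℕ} {g : ℕ+ → ℝ} (hg : g ∈ fiberSpan N m) :
    (fun d : ℕ+ => (d : ℝ)⁻¹ * g d) ∈ fiberSpan (N + 1) (m + 1) := by
  unfold fiberSpan at hg
  induction hg using Submodule.span_induction with
  | mem g hg =>
    obtain ⟨j, e, h1, h2, rfl⟩ := hg
    refine Submodule.subset_span ⟨j, e + 1, by omega, by omega, ?_⟩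
    funext d
    rw [pow_succ, mul_inv]
    ring
  | zero =>
    convert (fiberSpan (N + 1) (m + 1)).zero_mem using 1
    funext d
    simp
  | add x y _ _ hx hy =>
    convert add_mem hx hy using 1
    funext d
    simp [mul_add]
  | smul a x _ hx =>
    convert Submodule.smul_mem _ a hx using 1
    funext d
    simp [Rat.smul_def]
    ring

theorem fiberSpan_mono {N m m' : ℕ} (h : m' ≤ m) : fiberSpan N m ≤ fiberSpan N m' :=
  Submodule.span_mono fun _ ⟨j, e, h1, h2, h3⟩ => ⟨j, e, h1, h.trans h2, h3⟩

theorem tsum_mem_paritySpan {N m r : ℕ} {g : ℕ+ → ℝ} (hg : g ∈ fiberSpan N m)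
    (hm : 2 ≤ m + r) (hodd : Odd (N + r)) :
    Summable (fun d : ℕ+ => ((d : ℝ) ^ r)⁻¹ * g d) ∧
      ∑' d : ℕ+, ((d : ℝ) ^ r)⁻¹ * g d ∈ paritySpan (N + r) := by
  unfold fiberSpan at hg
  induction hg using Submodule.span_induction with
  | mem g hg =>
    obtain ⟨j, e, h1, h2, rfl⟩ := hg
    have hs := (hasSum_zetaVal (b := e + r) (by omega)).mul_left (π ^ (2 * j))
    have hs' : HasSum (fun d : ℕ+ => ((d : ℝ) ^ r)⁻¹ * (π ^ (2 * j) * ((d : ℝ) ^ e)⁻¹))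
        (π ^ (2 * j) * zetaVal (e + r)) := by
      refine hs.congr_fun fun d => ?_
      rw [pow_add, mul_inv]
      ring
    refine ⟨hs'.summable, ?_⟩
    rw [hs'.tsum_eq]
    have : Odd (e + r) := by grind
    refine Submodule.subset_span ⟨j, e + r, by omega, ?_, this, rfl⟩
    obtain ⟨k, hk⟩ := this
    omega
  | zero => simp [summable_zero]
  | add x y _ _ hx hy =>
    simp only [Pi.add_apply, mul_add]
    exact ⟨hx.1.add hy.1, by rw [hx.1.tsum_add hy.1]; exact add_mem hx.2 hy.2⟩
  | smul a x _ hx =>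
    have h : (fun d : ℕ+ => ((d : ℝ) ^ r)⁻¹ * (a • x) d) =
        fun d : ℕ+ => (a : ℝ) * (((d : ℝ) ^ r)⁻¹ * x d) := by
      funext d
      simp [Rat.smul_def]
      ring
    rw [h]
    refine ⟨hx.1.mul_left _, ?_⟩
    rw [tsum_mul_left, ← Rat.smul_def]
    exact Submodule.smul_mem _ a hx.2

theorem exists_zetaVal_even {k : ℕ} (hk : k ≠ 0) : ∃ c : ℚ, zetaVal (2 * k) = c * π ^ (2 * k) := by
  refine ⟨(-1) ^ (k + 1) * 2 ^ (2 * k - 1) * bernoulli (2 * k) / (2 * k).factorial, ?_⟩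
  have h := hasSum_zeta_nat hk
  rw [zetaVal, tsum_pnat_eq_tsum_succ (f := fun n : ℕ => 1 / (n : ℝ) ^ (2 * k))]
  have h2 := (hasSum_nat_add_iff' 1).2 h
  simp only [Finset.range_one, Finset.sum_singleton] at h2
  rw [h2.tsum_eq]
  have : 2 * k ≠ 0 := by omega
  push_cast
  simp [this]
  ring

theorem hasSum_invPow {q : ℕ} (hq : 2 ≤ q) :
    HasSum (invPow q) ((1 + (-1) ^ q) * zetaVal q) := by
  have hz := hasSum_zetaVal hq
  have key := HasSum.of_injective_pair (f := invPow q) (i := fun n : ℕ+ => ((n : ℕ) : ℤ))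
    (j := fun n : ℕ+ => -((n : ℕ) : ℤ)) (fun a b h => by simpa using h)
    (fun a b h => by simpa using h) (fun a b h => by have := a.pos; have := b.pos; omega) ?_
    (hz.congr_fun fun n => invPow_pnat q n)
    ((hz.mul_left ((-1) ^ q)).congr_fun fun n => by rw [invPow_neg, invPow_pnat])
  · rwa [add_mul, one_mul]
  · intro n h1 h2
    rcases lt_trichotomy n 0 with h | rfl | h
    · refine absurd ⟨⟨n.natAbs, by omega⟩, ?_⟩ h2
      simp only [PNat.mk_coe]
      omega
    · exact invPow_zero_right q
    · refine absurd ⟨⟨n.natAbs, by omega⟩, ?_⟩ h1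
      simp only [PNat.mk_coe]
      omega

theorem abs_invPow_le {p : ℕ} (hp : 1 ≤ p) (n : ℤ) : |invPow p n| ≤ |invPow 1 n| := by
  rcases eq_or_ne n 0 with rfl | hn
  · simp [invPow]
  · rw [invPow_of_ne_zero p hn, invPow_of_ne_zero 1 hn, abs_inv, abs_inv, abs_pow, abs_pow]
    have h1 : (1 : ℝ) ≤ |(n : ℝ)| := by exact_mod_cast Int.one_le_abs hn
    gcongr

theorem summable_invPow_mul_shift {p q : ℕ} (hp : 1 ≤ p) (hq : 1 ≤ q) (d : ℤ) :
    Summable fun n : ℤ => invPow p (n + d) * invPow q n := by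
  have h2 : Summable (invPow 2) := (hasSum_invPow le_rfl).summable
  have h2' : Summable fun n : ℤ => invPow 2 (n + d) := h2.comp_injective (add_left_injective d)
  have hsq : ∀ n, invPow 2 n = |invPow 1 n| ^ 2 := fun n => by
    rw [sq_abs]
    unfold invPow
    split_ifs <;> simp
  refine Summable.of_norm_bounded (h2'.add h2) fun n => ?_
  rw [Real.norm_eq_abs, abs_mul, hsq, hsq]
  calc |invPow p (n + d)| * |invPow q n| ≤ |invPow 1 (n + d)| * |invPow 1 n| :=
        mul_le_mul (abs_invPow_le hp _) (abs_invPow_le hq _) (abs_nonneg _) (abs_nonneg _)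
    _ ≤ |invPow 1 (n + d)| ^ 2 + |invPow 1 n| ^ 2 := by
        nlinarith [sq_nonneg (|invPow 1 (n + d)| - |invPow 1 n|), sq_nonneg |invPow 1 (n + d)|,
          sq_nonneg |invPow 1 n|]

theorem invPow_mul_shift_split (p q : ℕ) {d : ℤ} (hd : d ≠ 0) (n : ℤ) :
    invPow (p + 1) (n + d) * invPow (q + 1) n = (d : ℝ)⁻¹ *
      (invPow p (n + d) * invPow (q + 1) n - invPow (p + 1) (n + d) * invPow q n) := by
  rcases eq_or_ne n 0 with rfl | hn
  · simp [invPow_zero_right]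
  rcases eq_or_ne (n + d) 0 with h | h
  · simp [h, invPow_zero_right]
  simp only [invPow_of_ne_zero _ hn, invPow_of_ne_zero _ h]
  have hd' : (d : ℝ) ≠ 0 := by exact_mod_cast hd
  have hn' : (n : ℝ) ≠ 0 := by exact_mod_cast hn
  have h' : (n : ℝ) + d ≠ 0 := by exact_mod_cast h
  push_cast
  field_simp
  ring

theorem invPow_zero_shift_mul (q : ℕ) (d n : ℤ) :
    invPow 0 (n + d) * invPow q n = invPow q n - if n = -d then invPow q (-d) else 0 := by
  rcases eq_or_ne n (-d) with rfl | h
  · simp [invPow_zero_right]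
  · have : n + d ≠ 0 := fun h' => h (by omega)
    simp [h, invPow_of_ne_zero 0 this]

theorem invPow_shift_mul_zero (p : ℕ) (d n : ℤ) :
    invPow p (n + d) * invPow 0 n = invPow p (n + d) - if n = 0 then invPow p d else 0 := by
  rcases eq_or_ne n 0 with rfl | h
  · simp [invPow_zero_right]
  · simp [h, invPow_of_ne_zero 0 h]

theorem hasSum_invPow_one_sub_succ : HasSum (fun n : ℤ => invPow 1 n - invPow 1 (n + 1)) 0 := by
  have hsum : Summable fun n : ℤ => invPow 1 n - invPow 1 (n + 1) := by
    have h := summable_invPow_mul_shift le_rfl le_rfl 1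
    refine ((h.add (hasSum_ite_eq (-1 : ℤ) (invPow 1 (-1))).summable).sub
      (hasSum_ite_eq (0 : ℤ) (invPow 1 1)).summable).congr fun n => ?_
    have h1 := invPow_mul_shift_split 0 0 one_ne_zero n
    rw [zero_add, invPow_zero_shift_mul, invPow_shift_mul_zero] at h1
    rw [h1]
    push_cast
    ring
  have hlim : Filter.Tendsto (fun n : ℕ => invPow 1 n) Filter.atTop (nhds 0) := by
    refine (tendsto_inv_atTop_zero.comp tendsto_natCast_atTop_atTop).congr fun n => ?_
    rcases eq_or_ne n 0 with rfl | hn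
    · simp [invPow]
    · simp [invPow, hn]
  have hpos : HasSum (fun n : ℕ => invPow 1 (n : ℤ) - invPow 1 ((n : ℤ) + 1)) 0 := by
    refine (Summable.hasSum_iff_tendsto_nat (hsum.comp_injective Nat.cast_injective)).2 ?_
    have := hlim.const_sub (invPow 1 0)
    rw [invPow_zero_right, sub_zero] at this
    refine this.congr fun n => ?_
    have h := Finset.sum_range_sub' (fun i : ℕ => invPow 1 (i : ℤ)) n
    push_cast at h
    rw [invPow_zero_right] at h
    exact h.symm
  have hneg :
      HasSum (fun n : ℕ => invPow 1 (-((n : ℤ) + 1)) - invPow 1 (-((n : ℤ) + 1) + 1)) 0 := by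
    refine hpos.congr_fun fun n => ?_
    rw [show -((n : ℤ) + 1) + 1 = -(n : ℤ) by ring, invPow_neg, invPow_neg]
    ring
  have h := HasSum.of_nat_of_neg_add_one (f := fun n : ℤ => invPow 1 n - invPow 1 (n + 1)) hpos hneg
  rwa [add_zero] at h

theorem hasSum_invPow_one_sub_shift (d : ℕ) :
    HasSum (fun n : ℤ => invPow 1 n - invPow 1 (n + d)) 0 := by
  induction d with
  | zero => simp [hasSum_zero]
  | succ d ih =>
    have h := (Equiv.addRight (d : ℤ)).hasSum_iff.2 hasSum_invPow_one_sub_succ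
    have := ih.add h
    rw [add_zero] at this
    refine this.congr_fun fun n => ?_
    simp only [Function.comp, Equiv.coe_addRight]
    push_cast
    rw [add_assoc]
    ring

theorem hasSum_invPow_one_mul_shift (d : ℕ+) :
    HasSum (fun n : ℤ => invPow 1 (n + d) * invPow 1 n) (2 * ((d : ℝ) ^ 2)⁻¹) := by
  have hd : ((d : ℕ) : ℤ) ≠ 0 := by have := d.pos; omega
  have h := (((hasSum_invPow_one_sub_shift d).sub
    (hasSum_ite_eq (-((d : ℕ) : ℤ)) (invPow 1 (-((d : ℕ) : ℤ))))).add
      (hasSum_ite_eq (0 : ℤ) (invPow 1 ((d : ℕ) : ℤ)))).mul_left ((d : ℝ)⁻¹)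
  have hv : (d : ℝ)⁻¹ * (0 - invPow 1 (-((d : ℕ) : ℤ)) + invPow 1 ((d : ℕ) : ℤ)) =
      2 * ((d : ℝ) ^ 2)⁻¹ := by
    rw [invPow_neg, invPow_pnat]
    ring
  rw [hv] at h
  refine h.congr_fun fun n => ?_
  have h1 := invPow_mul_shift_split 0 0 hd n
  rw [zero_add, invPow_zero_shift_mul, invPow_shift_mul_zero] at h1
  rw [h1]
  push_cast
  ring

theorem hasSum_invPow_zero_shift_mul {q : ℕ} (hq : 2 ≤ q) (d : ℕ+) :
    HasSum (fun n : ℤ => invPow 0 (n + d) * invPow q n)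
      ((1 + (-1) ^ q) * zetaVal q - (-1) ^ q * ((d : ℝ) ^ q)⁻¹) := by
  have h := (hasSum_invPow hq).sub
    (hasSum_ite_eq (-((d : ℕ) : ℤ)) (invPow q (-((d : ℕ) : ℤ))))
  rw [invPow_neg, invPow_pnat] at h
  refine h.congr_fun fun n => ?_
  rw [invPow_zero_shift_mul, invPow_neg, invPow_pnat]

theorem hasSum_invPow_shift_mul_zero {p : ℕ} (hp : 2 ≤ p) (d : ℕ+) :
    HasSum (fun n : ℤ => invPow p (n + d) * invPow 0 n)
      ((1 + (-1) ^ p) * zetaVal p - ((d : ℝ) ^ p)⁻¹) := by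
  have h := ((Equiv.addRight ((d : ℕ) : ℤ)).hasSum_iff.2 (hasSum_invPow hp)).sub
    (hasSum_ite_eq (0 : ℤ) (invPow p ((d : ℕ) : ℤ)))
  rw [invPow_pnat] at h
  refine h.congr_fun fun n => ?_
  rw [invPow_shift_mul_zero, invPow_pnat]
  rfl

theorem const_add_smul_mem_fiberSpan {q : ℕ} (hq : 2 ≤ q) (c : ℚ) :
    (fun d : ℕ+ => (1 + (-1) ^ q) * zetaVal q + c * ((d : ℝ) ^ q)⁻¹) ∈ fiberSpan q 0 := by
  have h1 : (fun d : ℕ+ => (c : ℝ) * ((d : ℝ) ^ q)⁻¹) ∈ fiberSpan q 0 := by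
    convert (fiberSpan q 0).smul_mem c
      (Submodule.subset_span ⟨0, q, by omega, by omega, rfl⟩) using 1
    funext d
    simp [Rat.smul_def]
  refine add_mem (a := fun _ : ℕ+ => (1 + (-1) ^ q) * zetaVal q) ?_ h1
  rcases Nat.even_or_odd q with h | h
  · obtain ⟨k, rfl⟩ := h.two_dvd
    obtain ⟨a, ha⟩ := exists_zetaVal_even (k := k) (by omega)
    convert (fiberSpan (2 * k) 0).smul_mem (2 * a)
      (Submodule.subset_span ⟨k, 0, by omega, by omega, rfl⟩) using 1
    funext d
    simp [Rat.smul_def, ha]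
    ring
  · rw [h.neg_one_pow]
    convert (fiberSpan q 0).zero_mem using 1
    funext d
    simp

theorem tsum_invPow_mem_fiberSpan (p q : ℕ) (hpq : 2 ≤ p + q) :
    (∀ d : ℕ+, Summable fun n : ℤ => invPow p (n + d) * invPow q n) ∧
      (fun d : ℕ+ => ∑' n : ℤ, invPow p (n + d) * invPow q n) ∈ fiberSpan (p + q) (min p q) := by
  match p, q with
  | 0, q =>
    have h := hasSum_invPow_zero_shift_mul (q := q) (by omega)
    refine ⟨fun d => (h d).summable, ?_⟩
    rw [zero_add, Nat.zero_min]
    convert const_add_smul_mem_fiberSpan (q := q) (by omega) (-(-1) ^ q) using 1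
    funext d
    rw [(h d).tsum_eq]
    push_cast
    ring
  | p + 1, 0 =>
    have h := hasSum_invPow_shift_mul_zero (p := p + 1) (by omega)
    refine ⟨fun d => (h d).summable, ?_⟩
    rw [add_zero, Nat.min_zero]
    convert const_add_smul_mem_fiberSpan (q := p + 1) (by omega) (-1) using 1
    funext d
    rw [(h d).tsum_eq]
    push_cast
    ring
  | p + 1, q + 1 =>
    refine ⟨fun d => summable_invPow_mul_shift (by omega) (by omega) d, ?_⟩
    rcases Nat.eq_zero_or_pos (p + q) with h0 | h0
    · obtain ⟨rfl, rfl⟩ : p = 0 ∧ q = 0 := by omega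
      convert (fiberSpan (0 + 1 + (0 + 1)) (min (0 + 1) (0 + 1))).smul_mem 2
        (Submodule.subset_span ⟨0, 2, by omega, by omega, rfl⟩) using 1
      funext d
      have := (hasSum_invPow_one_mul_shift d).tsum_eq
      simp only [zero_add]
      rw [this]
      simp [Rat.smul_def]
    · obtain ⟨s1, m1⟩ := tsum_invPow_mem_fiberSpan p (q + 1) (by omega)
      obtain ⟨s2, m2⟩ := tsum_invPow_mem_fiberSpan (p + 1) q (by omega)
      have e : p + 1 + q = p + (q + 1) := by omega
      rw [e] at m2
      have h := fiberSpan_mul_inv (sub_mem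
        (fiberSpan_mono (m' := min p q) (by omega) m1)
        (fiberSpan_mono (m' := min p q) (by omega) m2))
      rw [show p + 1 + (q + 1) = p + (q + 1) + 1 by omega,
        show min (p + 1) (q + 1) = min p q + 1 by omega]
      convert h using 1
      funext d
      have hd : ((d : ℕ) : ℤ) ≠ 0 := by have := d.pos; omega
      rw [Pi.sub_apply, ← (s1 d).tsum_sub (s2 d), ← tsum_mul_left]
      exact tsum_congr fun n => by simpa using invPow_mul_shift_split p q hd n

theorem tornheim_parity {p q r : ℕ} (hp : 1 ≤ p) (hq : 1 ≤ q) (hpr : 2 ≤ p + r)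
    (hqr : 2 ≤ q + r) (hodd : Odd (p + q + r)) :
    tornheim r q p + (-1) ^ q * (tornheim p q r + (-1) ^ p * tornheim r p q) ∈
      paritySpan (p + q + r) := by
  have h := hasSum_pnat_int hp hq hpr hqr
  rw [← h.tsum_eq, h.summable.tsum_prod]
  simp only [tsum_mul_left]
  exact (tsum_mem_paritySpan (tsum_invPow_mem_fiberSpan p q (by omega)).2 (by omega) hodd).2

theorem zetaVal_mem_paritySpan {N : ℕ} (hN : 3 ≤ N) (hodd : Odd N) : zetaVal N ∈ paritySpan N :=
  Submodule.subset_span ⟨0, N, by omega, hN, hodd, by simp [zetaVal]⟩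

theorem zetaVal_even_mul_mem_paritySpan {k b : ℕ} (hk : k ≠ 0) (hb : 3 ≤ b) (hodd : Odd b) :
    zetaVal (2 * k) * zetaVal b ∈ paritySpan (2 * k + b) := by
  obtain ⟨c, hc⟩ := exists_zetaVal_even hk
  rw [hc, mul_assoc, ← Rat.smul_def]
  exact Submodule.smul_mem _ c (Submodule.subset_span ⟨k, b, rfl, hb, hodd, rfl⟩)

theorem zetaVal_mul_mem_paritySpan {p q : ℕ} (hp : 2 ≤ p) (hq : 2 ≤ q) (hodd : Odd (p + q)) :
    zetaVal p * zetaVal q ∈ paritySpan (p + q) := by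
  rcases Nat.even_or_odd p with h | h
  · obtain ⟨k, rfl⟩ := h.two_dvd
    have hq' : Odd q := by grind
    exact zetaVal_even_mul_mem_paritySpan (by omega) (by grind) hq'
  · have hq' : Even q := by grind
    obtain ⟨k, rfl⟩ := hq'.two_dvd
    rw [mul_comm (zetaVal p), add_comm p]
    exact zetaVal_even_mul_mem_paritySpan (by omega) (by grind) h

theorem mem_paritySpan_of_mul_two {N : ℕ} {x : ℝ} (h : x + x ∈ paritySpan N) :
    x ∈ paritySpan N := by
  convert (paritySpan N).smul_mem (1 / 2 : ℚ) h using 1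
  rw [Rat.smul_def]
  push_cast
  ring

theorem tornheim_zero_mem_paritySpan_of_two_le {p q : ℕ} (hp : 2 ≤ p) (hq : 2 ≤ q)
    (hodd : Odd (p + q)) : tornheim p 0 q ∈ paritySpan (p + q) := by
  have h1 := tornheim_parity (p := p) (q := q) (r := 0) (by omega) (by omega) hp hq hodd
  have h2 := zetaVal_stuffle hp hq
  have h3 := zetaVal_mul_mem_paritySpan hp hq hodd
  have h4 := zetaVal_mem_paritySpan (by omega) hodd
  have hsign : (-1 : ℝ) ^ q * (-1) ^ p = -1 := by
    rw [← pow_add, add_comm, hodd.neg_one_pow]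
  rw [mul_add, ← mul_assoc, hsign, tornheim_prod hp hq, tornheim_comm 0 q p,
    tornheim_comm 0 p q, add_zero] at h1
  have h5 : (-1) ^ q * (zetaVal p * zetaVal q) ∈ paritySpan (p + q) := by
    rcases neg_one_pow_eq_or ℝ q with h | h <;> rw [h]
    · simpa using h3
    · simpa using neg_mem h3
  apply mem_paritySpan_of_mul_two
  convert sub_mem (add_mem (sub_mem h3 h4) h5) h1 using 1
  rw [h2]
  ring

theorem tornheim_sum_sub_mem_paritySpan {r : ℕ} (hodd : Odd (r + 3)) (a b : ℕ) (hab : a + b = r) :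
    tornheim (a + 1) 1 (b + 1) - tornheim 1 0 (r + 2) - tornheim 1 0 (r + 2) ∈
      paritySpan (r + 3) := by
  induction a generalizing b with
  | zero =>
    obtain rfl : b = r := by omega
    rw [tornheim_split (by omega) (by omega), tornheim_comm 0]
    convert (paritySpan (b + 3)).zero_mem using 1
    simp only [zero_add]
    ring
  | succ a ih =>
    have h := tornheim_zero_mem_paritySpan_of_two_le (p := a + 2) (q := b + 2) (by omega)
      (by omega) (by rwa [show a + 2 + (b + 2) = r + 3 by omega])
    rw [show a + 2 + (b + 2) = r + 3 by omega] at h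
    rw [tornheim_split (by omega) (by omega)]
    convert add_mem (ih (b + 1) (by omega)) h using 1
    ring

theorem tornheim_one_zero_mem_paritySpan {r : ℕ} (hodd : Odd (r + 3)) :
    tornheim 1 0 (r + 2) ∈ paritySpan (r + 3) := by
  have h1 := tornheim_parity (p := 1) (q := 1) (r := r + 1) le_rfl le_rfl (by omega) (by omega)
    (by rwa [show 1 + 1 + (r + 1) = r + 3 by omega])
  have h2 := tornheim_sum_sub_mem_paritySpan hodd r 0 rfl
  have h3 := tornheim_sum_sub_mem_paritySpan hodd 0 r (zero_add r)
  rw [show 1 + 1 + (r + 1) = r + 3 by omega] at h1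
  apply mem_paritySpan_of_mul_two
  convert add_mem (sub_mem (sub_mem h1 h2) h2) h3 using 1
  ring_nf

theorem MZV_pair (k₁ k₂ : ℕ) : MZV [k₁, k₂] = tornheim k₁ 0 k₂ := by
  let e : ℕ+ × ℕ+ ≃ {f : Fin [k₁, k₂].length → ℕ+ // StrictMono f} :=
    Equiv.ofBijective
      (fun x => ⟨![x.1, x.1 + x.2], by
        refine Fin.strictMono_iff_lt_succ (n := 1).2 fun i => ?_
        rw [Subsingleton.elim i 0]
        exact PNat.lt_add_right x.1 x.2⟩)
      ⟨fun x y h => by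
        have h' := Subtype.ext_iff.1 h
        have h0 : x.1 = y.1 := congrFun h' (0 : Fin 2)
        have h1 : x.1 + x.2 = y.1 + y.2 := congrFun h' (1 : Fin 2)
        rw [h0] at h1
        exact Prod.ext h0 (add_left_cancel h1),
      fun f => by
        have hf : f.1 (0 : Fin 2) < f.1 (1 : Fin 2) := f.2 (Fin.zero_lt_one (n := 0))
        refine ⟨(f.1 (0 : Fin 2), f.1 (1 : Fin 2) - f.1 (0 : Fin 2)),
          Subtype.ext (funext fun i => ?_)⟩
        fin_cases i
        · rfl
        · exact PNat.add_sub_of_lt hf⟩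
  unfold MZV tornheim
  rw [← e.tsum_eq]
  refine tsum_congr fun x => ?_
  have : ∏ i : Fin 2, 1 / (((e x).1 i : ℕ) : ℝ) ^ [k₁, k₂].get i = tornheimTerm k₁ 0 k₂ x := by
    rw [Fin.prod_univ_two]
    change 1 / ((x.1 : ℕ) : ℝ) ^ k₁ * (1 / (((x.1 + x.2 : ℕ+) : ℕ) : ℝ) ^ k₂) = _
    simp [tornheimTerm, mul_comm]
  exact this

/-- Parity result in depth two: for `k₁ ≥ 1`, `k₂ ≥ 2` with `k₁ + k₂` odd, the double zeta
value `ζ(k₁,k₂)` lies in the ℚ-span of the products `π^{2a}·ζ(b)` of powers of `π²` and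
depth-one zeta values of total weight `2a + b = k₁ + k₂` (with `b ≥ 3` odd). -/
theorem parity_depth_two (k₁ k₂ : ℕ) (h₁ : 1 ≤ k₁) (h₂ : 2 ≤ k₂) (hodd : Odd (k₁ + k₂)) :
    MZV [k₁, k₂] ∈ Submodule.span ℚ {x : ℝ | ∃ a b : ℕ,
      2 * a + b = k₁ + k₂ ∧ 3 ≤ b ∧ Odd b ∧
      x = π ^ (2 * a) * ∑' n : ℕ+, 1 / ((n : ℕ) : ℝ) ^ b} := by
  change MZV [k₁, k₂] ∈ paritySpan (k₁ + k₂)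
  rw [MZV_pair]
  rcases Nat.lt_or_ge k₁ 2 with h | h
  · obtain rfl : k₁ = 1 := by omega
    obtain ⟨r, rfl⟩ := Nat.exists_eq_add_of_le' h₂
    rw [show 1 + (r + 2) = r + 3 by omega] at hodd ⊢
    exact tornheim_one_zero_mem_paritySpan hodd
  · exact tornheim_zero_mem_paritySpan_of_two_le h h₂ hodd
end

section
/- For positive integers k₁,…,k_d with k₁, k_d ≥ 2 and z ∈ ℂ \ ℤ, the multitangent function decomposes as Ψ_{k₁,…,k_d}(z) = ∑_{0≤i≤j≤d, j-i≤1} (-1)^{k₁+⋯+k_i} ζ^{(-z)}(k_i,…,k₁) · ζ^{(z)}(k_{j+1},…,k_d) · c_{i,j}(z), where c_{i,j}(z) = 1 if j = i and c_{i,j}(z) = 1/z^{k_j} if j = i+1, and empty Hurwitz multiple zeta values equal 1. -/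
open scoped BigOperators
open Real

/-- The Hurwitz multiple zeta value `ζ^{(z)}(l₁,…,l_r) = ∑_{0<n₁<⋯<n_r} ∏ 1/(z+n_i)^{l_i}`. -/
noncomputable def HMZV (z : ℂ) (l : List ℕ) : ℂ :=
  ∑' n : {f : Fin l.length → ℕ+ // StrictMono f}, ∏ i, 1 / (z + ((n.1 i : ℕ) : ℂ)) ^ l.get i

/-- The multitangent function `Ψ_{k₁,…,k_d}(z) = ∑_{-∞<m₁<⋯<m_d<∞} ∏ 1/(z+m_i)^{k_i}`. -/
noncomputable def MTF (k : List ℕ) (z : ℂ) : ℂ :=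
  ∑' m : {f : Fin k.length → ℤ // StrictMono f}, ∏ i, 1 / (z + (m.1 i : ℂ)) ^ k.get i

/-- The strictly increasing lists of length `d`. -/
def increasingLists (α : Type*) [LT α] (d : ℕ) : Set (List α) :=
  {l | l.Pairwise (· < ·) ∧ l.length = d}

/-- A strictly monotone function on `Fin d` is the same thing as an increasing list of length `d`. -/
noncomputable def strictMonoEquivIncreasingLists (α : Type*) [Preorder α] (d : ℕ) :
    {f : Fin d → α // StrictMono f} ≃ increasingLists α d :=
  Equiv.ofBijective
    (fun f => ⟨List.ofFn f.1, List.pairwise_ofFn.2 fun _ _ h => f.2 h, List.length_ofFn⟩) <| by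
    refine ⟨fun f g h => Subtype.ext (List.ofFn_injective (congrArg Subtype.val h)), ?_⟩
    rintro ⟨l, hl, rfl⟩
    refine ⟨⟨l.get, fun i j hij => List.pairwise_iff_get.1 hl i j hij⟩, ?_⟩
    exact Subtype.ext (List.ofFn_get l)

theorem prod_zipWith_ofFn {α β M : Type*} [CommMonoid M] (g : α → β → M) (k : List β)
    (f : Fin k.length → α) :
    (List.zipWith g (List.ofFn f) k).prod = ∏ i, g (f i) (k.get i) := by
  rw [← List.prod_ofFn]
  congr 1
  apply List.ext_getElem <;> simp

theorem tsum_strictMono_eq_tsum_increasingLists {α : Type*} [Preorder α] (g : α → ℕ → ℂ)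
    (k : List ℕ) :
    ∑' f : {f : Fin k.length → α // StrictMono f}, ∏ i, g (f.1 i) (k.get i) =
      ∑' l : increasingLists α k.length, (List.zipWith g l k).prod := by
  rw [← (strictMonoEquivIncreasingLists α k.length).tsum_eq]
  exact tsum_congr fun f => (prod_zipWith_ofFn g k f.1).symm

/-- The factor `1/(z+n)^k`. -/
noncomputable def hurwitzFactor (z : ℂ) (n : ℤ) (k : ℕ) : ℂ := 1 / (z + n) ^ k

/-- The summand `∏ 1/(z+n_i)^{k_i}`. -/
noncomputable def hurwitzTerm (z : ℂ) (l : List ℤ) (k : List ℕ) : ℂ :=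
  (List.zipWith (hurwitzFactor z) l k).prod

/-- The inclusion of positive naturals into the integers. -/
def pnatToInt (n : ℕ+) : ℤ := n

theorem pnatToInt_pos (n : ℕ+) : 0 < pnatToInt n := by
  simp [pnatToInt]

theorem pnatToInt_injective : Function.Injective pnatToInt := by
  intro a b h
  simpa [pnatToInt] using h

theorem pnatToInt_lt {a b : ℕ+} : pnatToInt a < pnatToInt b ↔ a < b := by
  simp [pnatToInt]

theorem exists_pnatToInt {m : ℤ} (hm : 0 < m) : ∃ n, pnatToInt n = m :=
  ⟨⟨m.toNat, by omega⟩, by simp [pnatToInt, hm.le]⟩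

theorem MTF_eq_tsum (k : List ℕ) (z : ℂ) :
    MTF k z = ∑' l : increasingLists ℤ k.length, hurwitzTerm z l k :=
  tsum_strictMono_eq_tsum_increasingLists (hurwitzFactor z) k

theorem HMZV_eq_tsum (z : ℂ) (k : List ℕ) :
    HMZV z k =
      ∑' l : increasingLists ℕ+ k.length, hurwitzTerm z (l.1.map pnatToInt) k := by
  simp only [hurwitzTerm, List.zipWith_map_left]
  rw [← tsum_strictMono_eq_tsum_increasingLists]
  simp [HMZV, hurwitzFactor, pnatToInt]

theorem prod_zipWith_inv_pow_le {ε : ℝ} (hε : 0 ≤ ε) (k : List ℕ) (hpos : ∀ i ∈ k, 0 < i)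
    (hne : k ≠ []) (hlast : 2 ≤ k.getLastD 0) (hk : k.length * ε ≤ 1) (l : List ℕ+)
    (hl : l.Pairwise (· < ·)) (hlen : l.length = k.length) (a : ℕ+) (ha : ∀ n ∈ l, a ≤ n) :
    (List.zipWith (fun (n : ℕ+) (k : ℕ) => (1 / (n : ℝ)) ^ k) l k).prod ≤
      (l.map fun n : ℕ+ => (n : ℝ) ^ (-(1 + ε))).prod * (a : ℝ) ^ (-(1 - k.length * ε)) := by
  induction k generalizing l a with
  | nil => exact absurd rfl hne
  | cons j k ih =>
    obtain _ | ⟨m, l⟩ := l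
    · simp at hlen
    have hm : (1 : ℝ) ≤ m := by exact_mod_cast (one_le : 1 ≤ m)
    have hm0 : (0 : ℝ) < m := by linarith
    have ha0 : (0 : ℝ) < a := by exact_mod_cast a.pos
    have ham : (a : ℝ) ≤ m := by exact_mod_cast ha m (by simp)
    have hmono : (m : ℝ) ^ (-(1 - (j :: k).length * ε)) ≤
        (a : ℝ) ^ (-(1 - (j :: k).length * ε)) :=
      Real.rpow_le_rpow_of_nonpos ha0 ham (by linarith)
    have hsplit : ∀ s : ℕ, s ≤ j → (1 / (m : ℝ)) ^ j ≤ (m : ℝ) ^ (-(s : ℝ)) := by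
      intro s hs
      rw [Real.rpow_neg hm0.le, Real.rpow_natCast, one_div, inv_pow]
      exact inv_anti₀ (by positivity) (pow_le_pow_right₀ hm hs)
    have hprod : 0 ≤ (l.map fun n : ℕ+ => (n : ℝ) ^ (-(1 + ε))).prod :=
      List.prod_nonneg (by simp only [List.mem_map]; rintro _ ⟨n, -, rfl⟩; positivity)
    simp only [List.zipWith_cons_cons, List.prod_cons, List.map_cons]
    by_cases hk0 : k = []
    · subst hk0
      obtain rfl : l = [] := by simpa using hlen
      simp only [List.zipWith_nil_left, List.prod_nil, List.map_nil, mul_one]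
      refine (hsplit 2 (by simpa using hlast)).trans ?_
      refine le_trans (le_of_eq ?_) (mul_le_mul_of_nonneg_left hmono (by positivity))
      rw [← Real.rpow_add hm0]
      congr 1
      simp
      ring
    · have hlen' : l.length = k.length := by simpa using hlen
      have hih := ih (fun i hi => hpos i (by simp [hi])) hk0
        (by obtain ⟨x, y, rfl⟩ := List.exists_cons_of_ne_nil hk0; simpa using hlast)
        (by refine le_trans ?_ hk; gcongr; simp) l (List.pairwise_cons.1 hl).2 hlen' m
        fun n hn => ((List.pairwise_cons.1 hl).1 n hn).le
      calc _ ≤ (m : ℝ) ^ (-((1 : ℕ) : ℝ)) *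
            ((l.map fun n : ℕ+ => (n : ℝ) ^ (-(1 + ε))).prod *
              (m : ℝ) ^ (-(1 - k.length * ε))) := by
            refine mul_le_mul (hsplit 1 (hpos j (by simp))) hih ?_ (by positivity)
            refine List.prod_nonneg fun x hx => ?_
            obtain ⟨i, hi, rfl⟩ := List.mem_iff_getElem.1 hx
            simp only [List.getElem_zipWith]
            positivity
        _ = (m : ℝ) ^ (-(1 + ε)) * (l.map fun n : ℕ+ => (n : ℝ) ^ (-(1 + ε))).prod *
              (m : ℝ) ^ (-(1 - (j :: k).length * ε)) := by
            have : (m : ℝ) ^ (-((1 : ℕ) : ℝ)) * (m : ℝ) ^ (-(1 - k.length * ε)) =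
                (m : ℝ) ^ (-(1 + ε)) * (m : ℝ) ^ (-(1 - (j :: k).length * ε)) := by
              rw [← Real.rpow_add hm0, ← Real.rpow_add hm0]
              congr 1
              push_cast [List.length_cons]
              ring
            linear_combination (l.map fun n : ℕ+ => (n : ℝ) ^ (-(1 + ε))).prod * this
        _ ≤ _ := mul_le_mul_of_nonneg_left hmono (by positivity)

theorem exists_norm_inv_add_le {z : ℂ} (hz : ∀ m : ℤ, z ≠ m) :
    ∃ C : ℝ, 0 ≤ C ∧ ∀ n : ℕ+, ‖1 / (z + (pnatToInt n : ℂ))‖ ≤ C * (1 / (n : ℝ)) := by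
  have hmem : z ∉ Set.range ((↑) : ℤ → ℂ) := by
    rintro ⟨m, rfl⟩
    exact hz m rfl
  obtain ⟨δ, hδ, hball⟩ := Metric.isOpen_iff.1 Complex.isClosed_range_intCast.isOpen_compl z hmem
  refine ⟨1 + ‖z‖ / δ, by positivity, fun n => ?_⟩
  have hdist : δ ≤ ‖z + (pnatToInt n : ℂ)‖ := by
    by_contra! h
    refine hball (?_ : ((-pnatToInt n : ℤ) : ℂ) ∈ Metric.ball z δ) ⟨_, rfl⟩
    rw [Metric.mem_ball', dist_eq_norm]
    simpa using h
  have hn : (0 : ℝ) < n := by exact_mod_cast n.pos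
  have htri : (n : ℝ) ≤ ‖z + (pnatToInt n : ℂ)‖ + ‖z‖ := by
    have h := norm_sub_le (z + (pnatToInt n : ℂ)) z
    simpa [pnatToInt] using h
  have hz' : ‖z‖ ≤ ‖z‖ / δ * ‖z + (pnatToInt n : ℂ)‖ := by
    rw [div_mul_eq_mul_div, le_div_iff₀ hδ]
    exact mul_le_mul_of_nonneg_left hdist (norm_nonneg z)
  rw [norm_div, norm_one, mul_one_div, div_le_div_iff₀ (hδ.trans_le hdist) hn]
  linarith

theorem norm_hurwitzTerm_map_le {z : ℂ} {C : ℝ} (hC : 0 ≤ C)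
    (h : ∀ n : ℕ+, ‖1 / (z + (pnatToInt n : ℂ))‖ ≤ C * (1 / (n : ℝ)))
    (l : List ℕ+) (k : List ℕ) (hlen : l.length = k.length) :
    ‖hurwitzTerm z (l.map pnatToInt) k‖ ≤
      C ^ k.sum * (List.zipWith (fun (n : ℕ+) (k : ℕ) => (1 / (n : ℝ)) ^ k) l k).prod := by
  induction k generalizing l with
  | nil => simp [hurwitzTerm]
  | cons j k ih =>
    obtain _ | ⟨m, l⟩ := l
    · simp at hlen
    have hih := ih l (by simpa using hlen)
    simp only [hurwitzTerm, List.map_cons, List.zipWith_cons_cons, List.prod_cons, norm_mul,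
      List.sum_cons, pow_add] at hih ⊢
    have hfac : ‖hurwitzFactor z (pnatToInt m) j‖ ≤ C ^ j * (1 / (m : ℝ)) ^ j := by
      rw [hurwitzFactor, ← one_div_pow, norm_pow, ← mul_pow]
      exact pow_le_pow_left₀ (norm_nonneg _) (h m) j
    calc _ ≤ _ := mul_le_mul hfac hih (norm_nonneg _) (by positivity)
      _ = _ := by ring

theorem summable_norm_hurwitzTerm {z : ℂ} (hz : ∀ m : ℤ, z ≠ m) (k : List ℕ)
    (hpos : ∀ i ∈ k, 0 < i) (hlast : k ≠ [] → 2 ≤ k.getLastD 0) :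
    Summable fun l : increasingLists ℕ+ k.length =>
      ‖hurwitzTerm z (l.1.map pnatToInt) k‖ := by
  by_cases hne : k = []
  · subst hne
    have : Finite (increasingLists ℕ+ ([] : List ℕ).length) :=
      Set.Finite.to_subtype ((Set.finite_singleton []).subset fun l hl => by
        simpa using hl.2)
    exact Summable.of_finite
  obtain ⟨C, hC, hbound⟩ := exists_norm_inv_add_le hz
  have hlen : (0 : ℝ) < k.length := by exact_mod_cast List.length_pos_of_ne_nil hne
  set ε : ℝ := 1 / k.length with hε
  have hε0 : 0 < ε := by positivity
  have hsum : Summable fun n : ℕ+ => ((n : ℕ) : ℝ) ^ (-(1 + ε)) :=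
    (Real.summable_nat_rpow.2 (by linarith)).comp_injective PNat.coe_injective
  have hfin := summable_finsetProd_of_summable_nonneg (fun n : ℕ+ => by positivity) hsum
  have hinj : Function.Injective fun l : increasingLists ℕ+ k.length => l.1.toFinset := by
    intro l l' h
    refine Subtype.ext (List.Perm.eq_of_pairwise' (r := (· < ·)) ?_ ?_ ?_)
    · exact l.2.1
    · exact l'.2.1
    · exact List.perm_of_nodup_nodup_toFinset_eq (l.2.1.imp ne_of_lt) (l'.2.1.imp ne_of_lt) h
  refine Summable.of_nonneg_of_le (fun _ => norm_nonneg _) (fun l => ?_)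
    ((hfin.comp_injective hinj).mul_left (C ^ k.sum))
  refine (norm_hurwitzTerm_map_le hC hbound l k l.2.2).trans
    (mul_le_mul_of_nonneg_left ?_ (by positivity))
  refine (prod_zipWith_inv_pow_le hε0.le k hpos hne (hlast hne) (by rw [hε]; field_simp; rfl)
    l l.2.1 l.2.2 1 fun n _ => one_le).trans (le_of_eq ?_)
  simp only [PNat.one_coe, Nat.cast_one, Real.one_rpow, mul_one, Function.comp]
  exact (List.prod_toFinset _ (l.2.1.imp ne_of_lt)).symm

/-- The list of integers with negative part `-a` (reversed), middle part `b` and positive part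
`c`. -/
def glueLists (b : List ℤ) (a c : List ℕ+) : List ℤ :=
  (a.reverse.map fun n => -pnatToInt n) ++ b ++ c.map pnatToInt

theorem filter_neg_glueLists {b : List ℤ} (hb : ∀ m ∈ b, m = 0) (a c : List ℕ+) :
    (glueLists b a c).filter (· < 0) = a.reverse.map fun n => -pnatToInt n := by
  have h₁ : (a.reverse.map fun n => -pnatToInt n).filter (· < 0) =
      a.reverse.map fun n => -pnatToInt n :=
    List.filter_eq_self.2 (by simp [pnatToInt_pos])
  have h₂ : b.filter (· < 0) = [] :=
    List.filter_eq_nil_iff.2 fun m hm => by simp [hb m hm]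
  have h₃ : (c.map pnatToInt).filter (· < 0) = [] :=
    List.filter_eq_nil_iff.2 (by simp [(pnatToInt_pos _).le])
  simp only [glueLists, List.filter_append, h₁, h₂, h₃, List.append_nil]

theorem filter_pos_glueLists {b : List ℤ} (hb : ∀ m ∈ b, m = 0) (a c : List ℕ+) :
    (glueLists b a c).filter (0 < ·) = c.map pnatToInt := by
  have h₁ : (a.reverse.map fun n => -pnatToInt n).filter (0 < ·) = [] :=
    List.filter_eq_nil_iff.2 (by simp [(pnatToInt_pos _).le])
  have h₂ : b.filter (0 < ·) = [] :=
    List.filter_eq_nil_iff.2 fun m hm => by simp [hb m hm]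
  have h₃ : (c.map pnatToInt).filter (0 < ·) = c.map pnatToInt :=
    List.filter_eq_self.2 (by simp [pnatToInt_pos])
  simp only [glueLists, List.filter_append, h₁, h₂, h₃, List.nil_append]

theorem glueLists_injective {b b' : List ℤ} (hb : ∀ m ∈ b, m = 0) (hb' : ∀ m ∈ b', m = 0)
    {a a' c c' : List ℕ+} (h : glueLists b a c = glueLists b' a' c') :
    b = b' ∧ a = a' ∧ c = c' := by
  have ha : a = a' := by
    have := congrArg (List.filter (· < 0)) h
    rw [filter_neg_glueLists hb, filter_neg_glueLists hb'] at this
    exact List.reverse_injective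
      (List.map_injective_iff.2 (neg_injective.comp pnatToInt_injective) this)
  have hc : c = c' := by
    have := congrArg (List.filter (0 < ·)) h
    rw [filter_pos_glueLists hb, filter_pos_glueLists hb'] at this
    exact List.map_injective_iff.2 pnatToInt_injective this
  subst ha hc
  simpa [glueLists] using h

theorem pairwise_glueLists {b : List ℤ} (hb : b = [] ∨ b = [0]) {a c : List ℕ+}
    (ha : a.Pairwise (· < ·)) (hc : c.Pairwise (· < ·)) :
    (glueLists b a c).Pairwise (· < ·) := by
  have hneg (x y : ℕ+) : -pnatToInt x < pnatToInt y := by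
    have := pnatToInt_pos x
    have := pnatToInt_pos y
    omega
  rcases hb with rfl | rfl <;>
    simp [glueLists, List.pairwise_append, List.pairwise_reverse, List.pairwise_map, pnatToInt_lt,
      pnatToInt_pos, ha, hc, hneg]

theorem exists_eq_glueLists (l : List ℤ) (hl : l.Pairwise (· < ·)) :
    ∃ b a c, (b = [] ∨ b = [0]) ∧ a.Pairwise (· < ·) ∧ c.Pairwise (· < ·) ∧
      l = glueLists b a c := by
  induction l with
  | nil => exact ⟨[], [], [], by simp [glueLists]⟩
  | cons m l ih =>
    obtain ⟨hm, hl⟩ := List.pairwise_cons.1 hl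
    obtain ⟨b, a, c, hb, ha, hc, rfl⟩ := ih hl
    rcases lt_or_ge m 0 with h | h
    · obtain ⟨n, hn⟩ := exists_pnatToInt (neg_pos.2 h)
      obtain rfl : m = -pnatToInt n := by omega
      refine ⟨b, a ++ [n], c, hb, ?_, hc, by simp [glueLists]⟩
      refine List.pairwise_append.2 ⟨ha, by simp, fun x hx y hy => ?_⟩
      obtain rfl : y = n := by simpa using hy
      have := hm (-pnatToInt x) (by simp [glueLists, pnatToInt_injective.eq_iff, hx])
      exact pnatToInt_lt.1 (by omega)
    · obtain rfl : a = [] := by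
        refine List.eq_nil_iff_forall_not_mem.2 fun x hx => ?_
        have := hm (-pnatToInt x) (by simp [glueLists, pnatToInt_injective.eq_iff, hx])
        have := pnatToInt_pos x
        omega
      obtain rfl : b = [] := by
        rcases hb with rfl | rfl
        · rfl
        · have := hm 0 (by simp [glueLists])
          omega
      rcases h.eq_or_lt with rfl | h
      · exact ⟨[0], [], c, by simp [glueLists, hc]⟩
      · obtain ⟨n, rfl⟩ := exists_pnatToInt h
        refine ⟨[], [], n :: c, .inl rfl, ha, List.pairwise_cons.2 ⟨fun x hx => ?_, hc⟩,
          by simp [glueLists]⟩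
        exact pnatToInt_lt.1 (hm _ (by simp [glueLists, pnatToInt_injective.eq_iff, hx]))

theorem hurwitzTerm_append (z : ℂ) {l₁ l₂ : List ℤ} {k₁ k₂ : List ℕ}
    (h : l₁.length = k₁.length) :
    hurwitzTerm z (l₁ ++ l₂) (k₁ ++ k₂) = hurwitzTerm z l₁ k₁ * hurwitzTerm z l₂ k₂ := by
  simp [hurwitzTerm, List.zipWith_append h]

theorem hurwitzTerm_reverse (z : ℂ) {l : List ℤ} {k : List ℕ} (h : l.length = k.length) :
    hurwitzTerm z l.reverse k.reverse = hurwitzTerm z l k := by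
  rw [hurwitzTerm, ← List.reverse_zipWith h, List.prod_reverse, hurwitzTerm]

theorem hurwitzTerm_map_neg (z : ℂ) (l : List ℤ) (k : List ℕ) (h : l.length = k.length) :
    hurwitzTerm z (l.map (-·)) k = (-1) ^ k.sum * hurwitzTerm (-z) l k := by
  induction k generalizing l with
  | nil => simp [hurwitzTerm]
  | cons j k ih =>
    obtain _ | ⟨m, l⟩ := l
    · simp at h
    have hih := ih l (by simpa using h)
    simp only [hurwitzTerm, List.map_cons, List.zipWith_cons_cons, List.prod_cons,
      List.sum_cons, pow_add] at hih ⊢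
    have hfac : hurwitzFactor z (-m) j = (-1) ^ j * hurwitzFactor (-z) m j := by
      have : z + ((-m : ℤ) : ℂ) = -1 * (-z + m) := by push_cast; ring
      rw [hurwitzFactor, hurwitzFactor, this, mul_pow, one_div, mul_inv, ← inv_pow,
        inv_neg_one, one_div]
    rw [hih, hfac]
    ring

theorem hurwitzTerm_glueLists (z : ℂ) {b : List ℤ} {a c : List ℕ+} {k₁ kb k₂ : List ℕ}
    (ha : a.length = k₁.length) (hb : b.length = kb.length) :
    hurwitzTerm z (glueLists b a c) (k₁ ++ kb ++ k₂) =
      (-1) ^ k₁.sum * hurwitzTerm z b kb *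
        (hurwitzTerm (-z) (a.map pnatToInt) k₁.reverse * hurwitzTerm z (c.map pnatToInt) k₂) := by
  have hneg : (a.reverse.map fun n => -pnatToInt n) = ((a.map pnatToInt).map (-·)).reverse := by
    simp [Function.comp_def]
  have hrev := hurwitzTerm_reverse z (l := (a.map pnatToInt).map (-·)) (k := k₁.reverse)
    (by simpa using ha)
  rw [List.reverse_reverse, hurwitzTerm_map_neg _ _ _ (by simpa using ha), List.sum_reverse]
    at hrev
  rw [glueLists, hneg, hurwitzTerm_append z (by simp [ha, hb]),
    hurwitzTerm_append z (by simp [ha]), hrev]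
  ring

/-- The increasing lists of integers with middle part `b`, with `p` negative and `q` positive
entries. -/
def glueSet (b : List ℤ) (p q : ℕ) : Set (List ℤ) :=
  (fun x : List ℕ+ × List ℕ+ => glueLists b x.1 x.2) ''
    (increasingLists ℕ+ p ×ˢ increasingLists ℕ+ q)

theorem disjoint_glueSet {b b' : List ℤ} (hb : ∀ m ∈ b, m = 0) (hb' : ∀ m ∈ b', m = 0)
    {p p' q q' : ℕ} (h : b ≠ b' ∨ p ≠ p') : Disjoint (glueSet b p q) (glueSet b' p' q') := by
  rw [Set.disjoint_left]
  rintro _ ⟨⟨a, c⟩, ⟨ha, -⟩, rfl⟩ ⟨⟨a', c'⟩, ⟨ha', -⟩, heq⟩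
  obtain ⟨h₁, h₂, -⟩ := glueLists_injective hb' hb heq
  have : p = p' := by rw [← ha.2, ← ha'.2, ← h₂]
  tauto

theorem hasSum_mul_of_summable_norm {α β : Type*} {f : α → ℂ} {g : β → ℂ}
    (hf : Summable fun x => ‖f x‖) (hg : Summable fun y => ‖g y‖) :
    HasSum (fun x : α × β => f x.1 * g x.2) ((∑' x, f x) * ∑' y, g y) := by
  rw [tsum_mul_tsum_of_summable_norm hf hg]
  exact (summable_mul_of_summable_norm hf hg).hasSum

theorem hasSum_glueSet {z : ℂ} (hz : ∀ m : ℤ, z ≠ m) {b : List ℤ} (hb : ∀ m ∈ b, m = 0)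
    {k₁ kb k₂ : List ℕ} (hlen : b.length = kb.length) (hpos₁ : ∀ i ∈ k₁, 0 < i)
    (hpos₂ : ∀ i ∈ k₂, 0 < i) (hfirst : k₁ ≠ [] → 2 ≤ k₁.headD 0)
    (hlast : k₂ ≠ [] → 2 ≤ k₂.getLastD 0) :
    HasSum ((fun l => hurwitzTerm z l (k₁ ++ kb ++ k₂)) ∘
        ((↑) : glueSet b k₁.length k₂.length → List ℤ))
      ((-1) ^ k₁.sum * hurwitzTerm z b kb * (HMZV (-z) k₁.reverse * HMZV z k₂)) := by
  have hz' : ∀ m : ℤ, -z ≠ m := fun m h => hz (-m) (by simp [← h])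
  have hs₁ := summable_norm_hurwitzTerm hz' k₁.reverse (by simpa using hpos₁) fun h => by
    have h' : k₁ ≠ [] := by simpa using h
    obtain ⟨x, y, rfl⟩ := List.exists_cons_of_ne_nil h'
    simpa using hfirst h'
  have hs₂ := summable_norm_hurwitzTerm hz k₂ hpos₂ hlast
  have hprod : HasSum
      (fun x : increasingLists ℕ+ k₁.reverse.length × increasingLists ℕ+ k₂.length =>
        hurwitzTerm (-z) (x.1.1.map pnatToInt) k₁.reverse *
          hurwitzTerm z (x.2.1.map pnatToInt) k₂)
      (HMZV (-z) k₁.reverse * HMZV z k₂) := by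
    rw [HMZV_eq_tsum, HMZV_eq_tsum]
    exact hasSum_mul_of_summable_norm
      (f := fun l : increasingLists ℕ+ k₁.reverse.length =>
        hurwitzTerm (-z) (l.1.map pnatToInt) k₁.reverse)
      (g := fun l : increasingLists ℕ+ k₂.length => hurwitzTerm z (l.1.map pnatToInt) k₂) hs₁ hs₂
  let φ : increasingLists ℕ+ k₁.reverse.length × increasingLists ℕ+ k₂.length → List ℤ :=
    fun x => glueLists b x.1 x.2
  have hφ : Function.Injective φ := by
    rintro ⟨a, c⟩ ⟨a', c'⟩ h
    obtain ⟨-, h₁, h₂⟩ := glueLists_injective hb hb h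
    exact Prod.ext (Subtype.ext h₁) (Subtype.ext h₂)
  have hrange : glueSet b k₁.length k₂.length = Set.range φ := by
    ext l
    constructor
    · rintro ⟨⟨a, c⟩, ⟨ha, hc⟩, rfl⟩
      exact ⟨(⟨a, by simpa using ha⟩, ⟨c, hc⟩), rfl⟩
    · rintro ⟨⟨a, c⟩, rfl⟩
      exact ⟨(a.1, c.1), ⟨by simpa using a.2, c.2⟩, rfl⟩
  rw [hrange]
  refine (hφ.hasSum_range_iff (f := fun l => hurwitzTerm z l (k₁ ++ kb ++ k₂))).2 ?_
  have hterm : (fun l => hurwitzTerm z l (k₁ ++ kb ++ k₂)) ∘ φ = fun x =>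
      (-1) ^ k₁.sum * hurwitzTerm z b kb *
        (hurwitzTerm (-z) (x.1.1.map pnatToInt) k₁.reverse *
          hurwitzTerm z (x.2.1.map pnatToInt) k₂) :=
    funext fun x => hurwitzTerm_glueLists z (by simpa using x.1.2.2) hlen
  rw [hterm]
  exact hprod.mul_left _

theorem increasingLists_eq_iUnion_glueSet (d : ℕ) :
    increasingLists ℤ d =
      ⋃ x ∈ (Finset.range (d + 1)).disjSum (Finset.range d),
        Sum.elim (fun i => glueSet [] i (d - i)) (fun i => glueSet [0] i (d - (i + 1))) x := by
  ext l
  simp only [Set.mem_iUnion, exists_prop]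
  constructor
  · rintro ⟨hl, rfl⟩
    obtain ⟨b, a, c, hb, ha, hc, rfl⟩ := exists_eq_glueLists l hl
    rcases hb with rfl | rfl
    · refine ⟨.inl a.length, by simp [glueLists], (a, c), ⟨⟨ha, rfl⟩, hc, ?_⟩, rfl⟩
      simp [glueLists]
    · refine ⟨.inr a.length, by simp [glueLists], (a, c), ⟨⟨ha, rfl⟩, hc, ?_⟩, rfl⟩
      simp [glueLists]
      omega
  · rintro ⟨i | i, hi, ⟨a, c⟩, ⟨⟨ha, rfl⟩, hc, hcd⟩, rfl⟩ <;>
      simp only [Finset.inl_mem_disjSum, Finset.inr_mem_disjSum, Finset.mem_range] at hi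
    · refine ⟨pairwise_glueLists (.inl rfl) ha hc, ?_⟩
      simp only [glueLists, List.length_append, List.length_map, List.length_reverse,
        List.length_nil] at *
      omega
    · refine ⟨pairwise_glueLists (.inr rfl) ha hc, ?_⟩
      simp only [glueLists, List.length_append, List.length_map, List.length_reverse,
        List.length_singleton] at *
      omega

/-- Decomposition of the multitangent function into Hurwitz multiple zeta values:
`Ψ_{k₁,…,k_d}(z) = ∑_{0≤i≤j≤d, j-i≤1} (-1)^{k₁+⋯+k_i} ζ^{(-z)}(k_i,…,k₁)·ζ^{(z)}(k_{j+1},…,k_d)·c_{i,j}(z)`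
where `c_{i,i} = 1` and `c_{i,i+1} = 1/z^{k_{i+1}}`. -/
theorem multitangent_decomposition (k : List ℕ) (hpos : ∀ i ∈ k, 0 < i) (hne : k ≠ [])
    (hfirst : 2 ≤ k.headD 0) (hlast : 2 ≤ k.getLastD 0)
    (z : ℂ) (hz : ∀ m : ℤ, z ≠ m) :
    MTF k z =
      (∑ i ∈ Finset.range (k.length + 1),
        (-1 : ℂ) ^ (k.take i).sum * HMZV (-z) ((k.take i).reverse) * HMZV z (k.drop i)) +
      ∑ i ∈ Finset.range k.length,
        (-1 : ℂ) ^ (k.take i).sum * HMZV (-z) ((k.take i).reverse) *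
          HMZV z (k.drop (i + 1)) * (1 / z ^ k.getD i 0) := by
  rw [MTF_eq_tsum, increasingLists_eq_iUnion_glueSet]
  have hhead (i : ℕ) (h : k.take i ≠ []) : 2 ≤ (k.take i).headD 0 := by
    obtain ⟨x, y, rfl⟩ := List.exists_cons_of_ne_nil hne
    obtain _ | i := i
    · simp at h
    · simpa using hfirst
  have htail (i : ℕ) (h : k.drop i ≠ []) : 2 ≤ (k.drop i).getLastD 0 := by
    rw [List.getLastD_eq_getLast?] at hlast ⊢
    rwa [List.getLast?_drop, if_neg (by simpa using h)]
  have htake (i : ℕ) : ∀ j ∈ k.take i, 0 < j := fun j hj => hpos j (List.mem_of_mem_take hj)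
  have hdrop (i : ℕ) : ∀ j ∈ k.drop i, 0 < j := fun j hj => hpos j (List.mem_of_mem_drop hj)
  have key := hasSum_sum_disjoint (f := fun l => hurwitzTerm z l k)
    ((Finset.range (k.length + 1)).disjSum (Finset.range k.length))
    (t := Sum.elim (fun i => glueSet [] i (k.length - i))
      (fun i => glueSet [0] i (k.length - (i + 1))))
    (a := Sum.elim
      (fun i => (-1) ^ (k.take i).sum * HMZV (-z) (k.take i).reverse * HMZV z (k.drop i))
      (fun i => (-1) ^ (k.take i).sum * HMZV (-z) (k.take i).reverse * HMZV z (k.drop (i + 1)) *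
        (1 / z ^ k.getD i 0))) ?_ ?_
  · rw [Finset.sum_disjSum] at key
    exact key.tsum_eq
  · rintro (i | i) - (j | j) - hij <;>
      exact disjoint_glueSet (by simp) (by simp) (by simp at hij ⊢ <;> exact hij)
  · rintro (i | i) hi <;>
      simp only [Finset.inl_mem_disjSum, Finset.inr_mem_disjSum, Finset.mem_range] at hi
    · have h := hasSum_glueSet hz (b := []) (kb := []) (by simp) rfl (htake i) (hdrop i) (hhead i)
        (htail i)
      rw [List.append_nil, List.take_append_drop, List.length_take, List.length_drop,
        min_eq_left (by omega)] at h
      change HasSum ((fun l => hurwitzTerm z l k) ∘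
          ((↑) : glueSet [] i (k.length - i) → List ℤ))
        ((-1) ^ (k.take i).sum * HMZV (-z) (k.take i).reverse * HMZV z (k.drop i))
      convert h using 1
      simp [hurwitzTerm, mul_assoc]
    · have h := hasSum_glueSet hz (b := [0]) (kb := [k[i]]) (by simp) rfl (htake i)
        (hdrop (i + 1)) (hhead i) (htail (i + 1))
      rw [List.append_assoc, List.singleton_append, List.cons_getElem_drop_succ,
        List.take_append_drop, List.length_take, List.length_drop, min_eq_left (by omega)] at h
      change HasSum ((fun l => hurwitzTerm z l k) ∘
          ((↑) : glueSet [0] i (k.length - (i + 1)) → List ℤ))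
        ((-1) ^ (k.take i).sum * HMZV (-z) (k.take i).reverse * HMZV z (k.drop (i + 1)) *
          (1 / z ^ k.getD i 0))
      convert h using 1
      simp [hurwitzTerm, hurwitzFactor, hi]
      ring
end

section
/- For positive integers l₁,…,l_r with l_r ≥ 2, the Hurwitz multiple zeta value z ↦ ζ^{(z)}(l₁,…,l_r) has Taylor expansion at z = 0 given by ζ^{(z)}(l₁,…,l_r) = ∑_{a=0}^∞ z^a ζ_a(l₁,…,l_r), where ζ_a(l₁,…,l_r) = (-1)^a ∑_{a₁+⋯+a_r=a, a_i≥0} ζ(l₁+a₁,…,l_r+a_r) ∏_{i=1}^r C(l_i-1+a_i, a_i), and the series converges for |z| < 1. -/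
open scoped BigOperators
open Real

/-- The Taylor coefficient `ζ_a(l₁,…,l_r) = (-1)^a ∑_{a₁+⋯+a_r=a} ζ(l₁+a₁,…,l_r+a_r)
∏ C(l_i-1+a_i, a_i)`. -/
noncomputable def zetaCoeff (a : ℕ) (l : List ℕ) : ℝ :=
  (-1 : ℝ) ^ a *
    ∑ f ∈ (Fintype.piFinset fun _ : Fin l.length => Finset.range (a + 1)).filter
        (fun f => ∑ i, f i = a),
      MZV (List.ofFn fun i => l.get i + f i) *
        ∏ i, (Nat.choose (l.get i - 1 + f i) (f i) : ℝ)

/-- A finite product of absolutely convergent series is the absolutely convergent series of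
products over the function space. -/
theorem summable_norm_and_tsum_prod_fin {R κ : Type*} [NormedField R] [CompleteSpace R] {r : ℕ}
    (f : Fin r → κ → R) (hf : ∀ i, Summable fun k => ‖f i k‖) :
    Summable (fun x : Fin r → κ => ‖∏ i, f i (x i)‖) ∧
      ∑' x : Fin r → κ, ∏ i, f i (x i) = ∏ i, ∑' k, f i k := by
  induction r with
  | zero => exact ⟨.of_finite, by simp⟩
  | succ r ih =>
    obtain ⟨hs, ht⟩ := ih (fun i => f i.succ) fun i => hf i.succ
    have hprod : ∀ p : κ × (Fin r → κ), ∏ i, f i (Fin.consEquiv (fun _ => κ) p i) =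
        f 0 p.1 * ∏ i : Fin r, f i.succ (p.2 i) := fun p => by
      simp [Fin.prod_univ_succ, Fin.consEquiv]
    constructor
    · rw [← (Fin.consEquiv fun _ => κ).summable_iff]
      refine ((hf 0).mul_norm hs).congr fun p => ?_
      simp only [Function.comp_apply, hprod]
    · rw [← (Fin.consEquiv fun _ => κ).tsum_eq, Fin.prod_univ_succ, ← ht,
        tsum_mul_tsum_of_summable_norm (hf 0) hs]
      exact tsum_congr hprod

/-- `MZV` of a list given by a function, as a sum over tuples indexed by the same `Fin r`. -/
theorem MZV_ofFn {r : ℕ} (g : Fin r → ℕ) :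
    MZV (List.ofFn g) =
      ∑' m : {f : Fin r → ℕ+ // StrictMono f}, ∏ i, 1 / ((m.1 i : ℕ) : ℝ) ^ g i := by
  have key : ∀ (k : List ℕ) (h : k.length = r), (∀ i, k.get i = g (Fin.cast h i)) →
      MZV k = ∑' m : {f : Fin r → ℕ+ // StrictMono f}, ∏ i, 1 / ((m.1 i : ℕ) : ℝ) ^ g i := by
    rintro k rfl h
    simp only [MZV, h, Fin.cast_refl, id_eq]
  exact key _ List.length_ofFn fun i => by simp; rfl

/-- Convergence of the multiple zeta series over strictly increasing tuples. -/
theorem summable_strictMono_prod_one_div_pow {r : ℕ} (k : Fin r → ℕ) (hpos : ∀ i, 0 < k i)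
    (hlast : ∀ i : Fin r, (i : ℕ) + 1 = r → 2 ≤ k i) :
    Summable fun n : {f : Fin r → ℕ+ // StrictMono f} =>
      ∏ i, 1 / ((n.1 i : ℕ) : ℝ) ^ k i := by
  cases r with
  | zero =>
    have : Finite {f : Fin 0 → ℕ+ // StrictMono f} := Subtype.finite
    exact .of_finite
  | succ r =>
    have hp : (1 : ℝ) < 1 + 1 / (r + 1) := by
      have : (0 : ℝ) < 1 / (r + 1) := by positivity
      linarith
    have hone : Summable fun m : ℕ+ => ‖1 / ((m : ℕ) : ℝ) ^ (1 + 1 / (r + 1) : ℝ)‖ :=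
      ((Real.summable_one_div_nat_rpow.2 hp).comp_injective PNat.coe_injective).norm
    have hall := (summable_norm_and_tsum_prod_fin
      (fun (_ : Fin (r + 1)) (m : ℕ+) => 1 / ((m : ℕ) : ℝ) ^ (1 + 1 / (r + 1) : ℝ))
      fun _ => hone).1
    refine (hall.comp_injective Subtype.val_injective).of_nonneg_of_le
      (fun n => by positivity) fun n => ?_
    obtain ⟨n, hn⟩ := n
    simp only [Function.comp_apply]
    have hn1 : ∀ i, (1 : ℝ) ≤ ((n i : ℕ) : ℝ) := fun i => by exact_mod_cast one_le
    have hn0 : ∀ i, (0 : ℝ) < ((n i : ℕ) : ℝ) := fun i => by linarith [hn1 i]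
    rw [Real.norm_of_nonneg (Finset.prod_nonneg fun i _ => by positivity)]
    simp only [one_div, Finset.prod_inv_distrib]
    refine inv_anti₀ (Finset.prod_pos fun i _ => Real.rpow_pos_of_pos (hn0 i) _) ?_
    have hsplit : ∀ i, ((n i : ℕ) : ℝ) ^ (1 + (r + 1 : ℝ)⁻¹) =
        ((n i : ℕ) : ℝ) * ((n i : ℕ) : ℝ) ^ (r + 1 : ℝ)⁻¹ := fun i => by
      rw [Real.rpow_add (hn0 i), Real.rpow_one]
    simp only [hsplit, Finset.prod_mul_distrib]
    have hlastfac : ∏ i, ((n i : ℕ) : ℝ) ^ (r + 1 : ℝ)⁻¹ ≤ ((n (Fin.last r) : ℕ) : ℝ) := by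
      calc ∏ i, ((n i : ℕ) : ℝ) ^ (r + 1 : ℝ)⁻¹
          ≤ ∏ _i : Fin (r + 1), ((n (Fin.last r) : ℕ) : ℝ) ^ (r + 1 : ℝ)⁻¹ := by
            refine Finset.prod_le_prod (fun i _ => by positivity) fun i _ => ?_
            refine Real.rpow_le_rpow (hn0 i).le ?_ (by positivity)
            exact_mod_cast hn.monotone (Fin.le_last i)
        _ = ((n (Fin.last r) : ℕ) : ℝ) := by
            rw [Finset.prod_const, Finset.card_univ, Fintype.card_fin, ← Real.rpow_natCast,
              ← Real.rpow_mul (hn0 _).le]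
            push_cast
            rw [inv_mul_cancel₀ (by positivity), Real.rpow_one]
    calc (∏ i, ((n i : ℕ) : ℝ)) * ∏ i, ((n i : ℕ) : ℝ) ^ (r + 1 : ℝ)⁻¹
        ≤ (∏ i, ((n i : ℕ) : ℝ)) * ((n (Fin.last r) : ℕ) : ℝ) :=
          mul_le_mul_of_nonneg_left hlastfac (Finset.prod_nonneg fun i _ => (hn0 i).le)
      _ = (∏ i : Fin r, ((n i.castSucc : ℕ) : ℝ)) * ((n (Fin.last r) : ℕ) : ℝ) ^ 2 := by
          rw [Fin.prod_univ_castSucc]; ring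
      _ ≤ (∏ i : Fin r, ((n i.castSucc : ℕ) : ℝ) ^ k i.castSucc) *
            ((n (Fin.last r) : ℕ) : ℝ) ^ k (Fin.last r) := by
          refine mul_le_mul (Finset.prod_le_prod (fun i _ => (hn0 _).le) fun i _ => ?_)
            (pow_le_pow_right₀ (hn1 _) (hlast _ (by simp))) (by positivity)
            (Finset.prod_nonneg fun i _ => by positivity)
          exact le_self_pow₀ (hn1 _) (hpos _).ne'
      _ = ∏ i, ((n i : ℕ) : ℝ) ^ k i :=
          (Fin.prod_univ_castSucc fun i => ((n i : ℕ) : ℝ) ^ k i).symm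

/-- Binomial expansion of `1 / (z + n) ^ l` in powers of `-z`. -/
theorem hasSum_one_div_add_pow {l : ℕ} (hl : 0 < l) {z : ℂ} (hz : ‖z‖ < 1) (n : ℕ+) :
    HasSum (fun k : ℕ => ((l - 1 + k).choose k : ℂ) * (-z) ^ k / ((n : ℕ) : ℂ) ^ (l + k))
      (1 / (z + ((n : ℕ) : ℂ)) ^ l) := by
  obtain ⟨l, rfl⟩ : ∃ m, l = m + 1 := ⟨l - 1, by omega⟩
  have hn : ((n : ℕ) : ℂ) ≠ 0 := by exact_mod_cast n.ne_zero
  have hn1 : (1 : ℝ) ≤ ((n : ℕ) : ℝ) := by exact_mod_cast one_le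
  have hr : ‖-z / ((n : ℕ) : ℂ)‖ < 1 := by
    rw [norm_div, norm_neg, Complex.norm_natCast, div_lt_one (by linarith)]
    linarith
  have h := (hasSum_choose_mul_geometric_of_norm_lt_one l hr).mul_left
    (1 / ((n : ℕ) : ℂ) ^ (l + 1))
  convert! h using 1
  · ext k
    have hc : (l + 1 - 1 + k).choose k = (k + l).choose l := by
      rw [Nat.add_sub_cancel, add_comm l k, Nat.choose_symm_add]
    rw [hc, div_pow, pow_add _ (l + 1) k]
    field_simp
  · rw [div_mul_div_comm, one_mul, ← mul_pow]
    congr 2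
    field_simp
    ring

/-- Taylor expansion of the Hurwitz multiple zeta value at `z = 0`:
`ζ^{(z)}(l₁,…,l_r) = ∑_{a≥0} z^a ζ_a(l₁,…,l_r)`, absolutely convergent for `|z| < 1`. -/
theorem hurwitz_taylor (l : List ℕ) (hpos : ∀ i ∈ l, 0 < i) (hlast : 2 ≤ l.getLastD 2)
    (z : ℂ) (hz : ‖z‖ < 1) :
    Summable (fun a : ℕ => ‖z ^ a * ((zetaCoeff a l : ℝ) : ℂ)‖) ∧
    HMZV z l = ∑' a : ℕ, z ^ a * ((zetaCoeff a l : ℝ) : ℂ) := by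
  have hget : ∀ i, 0 < l.get i := fun i => hpos _ (l.get_mem i)
  have hlast_get : ∀ i : Fin l.length, (i : ℕ) + 1 = l.length → 2 ≤ l.get i := by
    intro i hi
    have hne : l ≠ [] := by
      rintro rfl
      exact i.elim0
    have : l.getLastD 2 = l.get i := by
      rw [List.getLastD_eq_getLast?, List.getLast?_eq_some_getLast hne, Option.getD_some,
        List.getLast_eq_getElem]
      simp [← hi]
    omega
  set T := {f : Fin l.length → ℕ+ // StrictMono f}
  let c : (Fin l.length → ℕ) → ℕ := fun f => ∏ i, (l.get i - 1 + f i).choose (f i)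
  let F : T × (Fin l.length → ℕ) → ℂ := fun p => ∏ i,
    ((l.get i - 1 + p.2 i).choose (p.2 i) : ℂ) * (-z) ^ p.2 i /
      ((p.1.1 i : ℕ) : ℂ) ^ (l.get i + p.2 i)
  have hcoef : ∀ i : Fin l.length,
      Summable fun k : ℕ => ‖((l.get i - 1 + k).choose k : ℝ) * ‖z‖ ^ k‖ := by
    intro i
    refine (summable_choose_mul_geometric_of_norm_lt_one (R := ℝ) (l.get i - 1)
      (r := ‖z‖) (by rwa [norm_norm])).norm.congr fun k => ?_
    rw [add_comm k, Nat.choose_symm_add]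
  have hF : Summable F := by
    refine Summable.of_norm_bounded ((summable_strictMono_prod_one_div_pow (fun i => l.get i)
      hget hlast_get).mul_of_nonneg (summable_norm_and_tsum_prod_fin
        (fun i k => ((l.get i - 1 + k).choose k : ℝ) * ‖z‖ ^ k) hcoef).1
        (fun n => Finset.prod_nonneg fun i _ => by positivity) (fun f => norm_nonneg _)) ?_
    rintro ⟨n, f⟩
    rw [Real.norm_of_nonneg (Finset.prod_nonneg fun i _ => by positivity),
      ← Finset.prod_mul_distrib, norm_prod]
    refine Finset.prod_le_prod (fun i _ => norm_nonneg _) fun i _ => ?_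
    have hn1 : (1 : ℝ) ≤ ((n.1 i : ℕ) : ℝ) := by exact_mod_cast one_le
    rw [norm_div, norm_mul, norm_pow, norm_pow, norm_neg, Complex.norm_natCast,
      Complex.norm_natCast, one_div_mul_eq_div]
    exact div_le_div_of_nonneg_left (by positivity) (by positivity)
      (pow_le_pow_right₀ hn1 (Nat.le_add_right _ _))
  have hrow : ∀ n : T, ∑' f, F (n, f) = ∏ i, 1 / (z + ((n.1 i : ℕ) : ℂ)) ^ l.get i := by
    intro n
    have h := fun i => hasSum_one_div_add_pow (hget i) hz (n.1 i)
    rw [(summable_norm_and_tsum_prod_fin _ fun i => (h i).summable.norm).2]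
    exact Finset.prod_congr rfl fun i _ => (h i).tsum_eq
  have hcol : ∀ f, ∑' n, F (n, f) =
      (-z) ^ (∑ i, f i) * ((MZV (List.ofFn fun i => l.get i + f i) * c f : ℝ) : ℂ) := by
    intro f
    rw [MZV_ofFn, Complex.ofReal_mul, Complex.ofReal_tsum, mul_comm (tsum _), ← mul_assoc,
      ← tsum_mul_left]
    refine tsum_congr fun n => ?_
    simp only [F, c, Finset.prod_div_distrib, Finset.prod_mul_distrib, Finset.prod_pow_eq_pow_sum]
    push_cast
    simp only [Finset.prod_const_one]
    ring
  have hG : Summable fun f => ∑' n, F (n, f) := hF.prod_symm.prod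
  have hGs := (Equiv.sigmaFiberEquiv fun f : Fin l.length → ℕ => ∑ i, f i).summable_iff.2 hG
  have hfib : ∀ a : ℕ, ∑' f : {f : Fin l.length → ℕ // ∑ i, f i = a}, ∑' n, F (n, f.1) =
      z ^ a * ((zetaCoeff a l : ℝ) : ℂ) := by
    intro a
    have hmem : ∀ f : Fin l.length → ℕ, f ∈ (Fintype.piFinset fun _ : Fin l.length =>
        Finset.range (a + 1)).filter (fun f => ∑ i, f i = a) ↔ ∑ i, f i = a := by
      intro f
      simp only [Finset.mem_filter, Fintype.mem_piFinset, Finset.mem_range, and_iff_right_iff_imp]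
      rintro rfl i
      exact Nat.lt_succ_of_le (Finset.single_le_sum (fun j _ => Nat.zero_le (f j))
        (Finset.mem_univ i))
    rw [← (Equiv.subtypeEquivRight hmem).tsum_eq]
    simp only [Equiv.subtypeEquivRight_apply_coe]
    rw [Finset.tsum_subtype _ fun f => ∑' n, F (n, f), zetaCoeff, Complex.ofReal_mul,
      Complex.ofReal_sum, ← mul_assoc, Finset.mul_sum]
    refine Finset.sum_congr rfl fun f hf => ?_
    rw [hcol, (hmem f).1 hf, neg_pow]
    simp only [c]
    push_cast
    ring
  constructor
  · refine (hGs.sigma.congr fun a => ?_).norm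
    exact hfib a
  · calc HMZV z l = ∑' n : T, ∑' f, F (n, f) := (tsum_congr hrow).symm
      _ = ∑' f, ∑' n, F (n, f) := (hF.tsum_comm (f := fun n f => F (n, f))).symm
      _ = ∑' a : ℕ, ∑' f : {f : Fin l.length → ℕ // ∑ i, f i = a}, ∑' n, F (n, f.1) := by
          rw [← (Equiv.sigmaFiberEquiv fun f : Fin l.length → ℕ => ∑ i, f i).tsum_eq]
          exact hGs.tsum_sigma
      _ = _ := tsum_congr hfib
end
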